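/- arXiv:2310.20591 — 2 statements merged into one kernel-verified Lean document; each statement's English description precedes it below -/
import Mathlib

section
/- Let A be a sheaf of rings on a topological space X, M a sheaf of A-modules, φ : M ↠ N an epimorphism of sheaves of A-modules, and f : A → N a morphism of sheaves of A-modules. Then for any x ∈ X there exists an open neighborhood U of x and a morphism g : A|_U → M|_U of sheaves of A|_U-modules such that φ|_U ∘ g = f|_U. -/
/-!
Finiteness conditions for sheaves of modules over a sheaf of rings on a
topological space `X`, following the paper. We use the Grothendieck topology
on `Opens X`; the restriction of a sheaf of modules to an open subset `U`
is given by `SheafOfModules.over`, and the further restriction of a sheaf of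
`A|_U`-modules to a smaller open `V ≤ U` is given by pushforward to the
site `(J.over U).over V`.
-/

universe u

open CategoryTheory Limits TopologicalSpace

namespace CoherentSheaves

variable {X : TopCat.{u}} {R : Sheaf (Opens.grothendieckTopology X) RingCat.{u}}

/-- The restriction of a sheaf of `A|_U`-modules to a smaller open `V ≤ U`. -/
noncomputable abbrev resOver {U : Opens X} (N : SheafOfModules.{u} (R.over U))
    {V : Opens X} (h : V ≤ U) :
    SheafOfModules.{u} ((R.over U).over (Over.mk (homOfLE h))) :=
  N.over (Over.mk (homOfLE h))

/-- The restriction of a morphism of sheaves of modules to an open subset `U`. -/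
noncomputable abbrev resMap {M N : SheafOfModules.{u} R} (φ : M ⟶ N) (U : Opens X) :
    M.over U ⟶ N.over U :=
  (SheafOfModules.pushforward (𝟙 _)).map φ

/-- A sheaf of `A|_U`-modules `N` is locally finitely generated if every `x ∈ U` has an
open neighborhood `V ≤ U` on which `N` admits an epimorphism from a finite free module. -/
def IsLFGOver {U : Opens X} (N : SheafOfModules.{u} (R.over U)) : Prop :=
  ∀ x ∈ U, ∃ (V : Opens X) (h : V ≤ U), x ∈ V ∧ ∃ n : ℕ, 0 < n ∧
    ∃ p : SheafOfModules.free (ULift.{u} (Fin n)) ⟶ resOver N h, Epi p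

/-- A sheaf of `A|_U`-modules `N` is locally finitely presented if every `x ∈ U` has an
open neighborhood `V ≤ U` on which there is an exact sequence
`(A|_V)^{⊕m} ⟶ (A|_V)^{⊕n} ⟶ N|_V ⟶ 0`. -/
def IsLFPOver {U : Opens X} (N : SheafOfModules.{u} (R.over U)) : Prop :=
  ∀ x ∈ U, ∃ (V : Opens X) (h : V ≤ U), x ∈ V ∧ ∃ m n : ℕ, 0 < m ∧ 0 < n ∧
    ∃ (f : (SheafOfModules.free (ULift.{u} (Fin m)) :
              SheafOfModules.{u} ((R.over U).over (Over.mk (homOfLE h)))) ⟶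
             SheafOfModules.free (ULift.{u} (Fin n)))
      (p : SheafOfModules.free (ULift.{u} (Fin n)) ⟶ resOver N h)
      (w : f ≫ p = 0), Epi p ∧ (ShortComplex.mk f p w).Exact

/-- A sheaf of `A`-modules `M` is locally finitely generated if every `x ∈ X` has an
open neighborhood `U` on which `M` admits an epimorphism from a finite free module. -/
def IsLFG (M : SheafOfModules.{u} R) : Prop :=
  ∀ x : X, ∃ U : Opens X, x ∈ U ∧ ∃ n : ℕ, 0 < n ∧
    ∃ p : SheafOfModules.free (ULift.{u} (Fin n)) ⟶ M.over U, Epi p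

/-- A sheaf of `A`-modules `M` is locally finitely presented if every `x ∈ X` has an
open neighborhood `U` on which there is an exact sequence
`(A|_U)^{⊕m} ⟶ (A|_U)^{⊕n} ⟶ M|_U ⟶ 0`. -/
def IsLFP (M : SheafOfModules.{u} R) : Prop :=
  ∀ x : X, ∃ U : Opens X, x ∈ U ∧ ∃ m n : ℕ, 0 < m ∧ 0 < n ∧
    ∃ (f : (SheafOfModules.free (ULift.{u} (Fin m)) :
              SheafOfModules.{u} (R.over U)) ⟶ SheafOfModules.free (ULift.{u} (Fin n)))
      (p : SheafOfModules.free (ULift.{u} (Fin n)) ⟶ M.over U)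
      (w : f ≫ p = 0), Epi p ∧ (ShortComplex.mk f p w).Exact

/-- A sheaf of `A`-modules `M` is pseudo-coherent if for every open `U`, every locally
finitely generated `A|_U`-submodule of `M|_U` is locally finitely presented. -/
def IsPseudoCoherent (M : SheafOfModules.{u} R) : Prop :=
  ∀ (U : Opens X) (N : SheafOfModules.{u} (R.over U)) (ι : N ⟶ M.over U),
    Mono ι → IsLFGOver N → IsLFPOver N

/-- A sheaf of `A`-modules is coherent if it is locally finitely generated
and pseudo-coherent. -/
def IsCoherent (M : SheafOfModules.{u} R) : Prop :=
  IsLFG M ∧ IsPseudoCoherent M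

section LocallySurjective

universe v w

variable {C : Type w} [Category.{v} C] {J : GrothendieckTopology C}

/-- Presheaf cokernels of modules are exact on sections. -/
lemma exists_app_eq_of_cokernel_π_app_eq_zero {R : Cᵒᵖ ⥤ RingCat.{u}}
    {M N : PresheafOfModules.{u} R} (φ : M ⟶ N) {V : Cᵒᵖ} (s : N.obj V)
    (hs : (cokernel.π φ).app V s = 0) : ∃ t : M.obj V, φ.app V t = s :=
  (ShortComplex.moduleCat_exact_iff _).1
    ((ShortComplex.exact_cokernel φ).map (PresheafOfModules.evaluation R V)) s hs

/-- An epimorphism of sheaves of modules is locally surjective. -/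
lemma isLocallySurjective_of_epi {R : Sheaf J RingCat.{u}}
    [HasWeakSheafify J AddCommGrpCat.{u}] [J.WEqualsLocallyBijective AddCommGrpCat.{u}]
    {M N : SheafOfModules.{u} R} (φ : M ⟶ N) [Epi φ] :
    PresheafOfModules.IsLocallySurjective J φ.val where
  imageSieve_mem {V} s := by
    let η := (PresheafOfModules.sheafificationAdjunction (𝟙 R.obj)).unit.app (cokernel φ.val)
    let g : N ⟶ (PresheafOfModules.sheafification (𝟙 R.obj)).obj (cokernel φ.val) :=
      ⟨cokernel.π φ.val ≫ η⟩
    have hφ : φ ≫ g = 0 := by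
      ext1
      exact (cokernel.condition_assoc φ.val η).trans zero_comp
    have hg : g = 0 := by rw [← cancel_epi φ, hφ, comp_zero]
    refine J.superset_covering ?_ (Presheaf.equalizerSieve_mem J
      (CategoryTheory.toSheafify J (cokernel φ.val).presheaf)
      ((cokernel.π φ.val).app _ s) 0 ?_)
    · intro W i hi
      refine exists_app_eq_of_cokernel_π_app_eq_zero φ.val (V := .op W)
        (N.val.map i.op s) ?_
      exact (PresheafOfModules.naturality_apply _ i.op s).trans <| hi.trans (map_zero _)
    · rw [map_zero]
      exact congr_arg (fun k : N ⟶ _ => k.val.app _ s) hg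

end LocallySurjective

/-- The section of `M.over U` determined by an element of `M(U)`. -/
noncomputable def overSection (M : SheafOfModules.{u} R) {U : Opens X} (t : M.val.obj (.op U)) :
    (M.over U).sections :=
  PresheafOfModules.sectionsMk (fun V => M.val.presheaf.map V.unop.hom.op t) (fun V W i => by
    change (M.val.presheaf.map V.unop.hom.op ≫ M.val.presheaf.map i.unop.left.op) t = _
    rw [← Functor.map_comp]
    rfl)

/-- A morphism `f : A ⟶ N` lifts locally along any epimorphism `φ : M ↠ N`. -/
theorem exists_local_lift (M N : SheafOfModules.{u} R) (φ : M ⟶ N) [Epi φ]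
    (f : SheafOfModules.unit R ⟶ N) (x : X) :
    ∃ U : Opens X, x ∈ U ∧ ∃ g : (SheafOfModules.unit R).over U ⟶ M.over U,
      g ≫ resMap φ U = resMap f U := by
  have := isLocallySurjective_of_epi φ
  obtain ⟨U, i, ⟨t, ht⟩, hx⟩ := Presheaf.imageSieve_mem (Opens.grothendieckTopology X)
    ((PresheafOfModules.toPresheaf _).map φ.val) (U := .op ⊤)
    ((N.unitHomEquiv f).eval (.op ⊤)) x trivial
  refine ⟨U, hx, (M.over U).unitHomEquiv.symm (overSection M t), ?_⟩
  refine (SheafOfModules.unitHomEquiv_symm_comp _ _).trans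
    ((Equiv.symm_apply_eq _).2 (PresheafOfModules.sections_ext _ _ fun V => ?_))
  have h : N.val.presheaf.map V.unop.hom.op (φ.val.app (.op U) t) =
      N.val.presheaf.map V.unop.hom.op ((N.unitHomEquiv f).eval (.op U)) :=
    congr_arg _ (ht.trans (PresheafOfModules.sections_property (N.unitHomEquiv f) i.op))
  exact (PresheafOfModules.naturality_apply φ.val V.unop.hom.op t).trans
    (h.trans (PresheafOfModules.sections_property (N.unitHomEquiv f) V.unop.hom.op))

end CoherentSheaves
end

section
/- Let 0 → M' → M → M'' → 0 be a short exact sequence of sheaves of A-modules. If M is coherent over A and M'' is locally finitely presented over A, then M' is coherent over A. -/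
/-!
Finiteness conditions for sheaves of modules over a sheaf of rings on a
topological space `X`, following the paper. We use the Grothendieck topology
on `Opens X`; the restriction of a sheaf of modules to an open subset `U`
is given by `SheafOfModules.over`, and the further restriction of a sheaf of
`A|_U`-modules to a smaller open `V ≤ U` is given by pushforward to the
site `(J.over U).over V`.
-/

universe u

open CategoryTheory Limits TopologicalSpace

namespace SheafOfModules

open Opposite

universe v₁ u₁

variable {C : Type u₁} [Category.{v₁} C] {J : GrothendieckTopology C} {R : Sheaf J RingCat.{u}}

theorem app_injective {M N : SheafOfModules.{u} R} (f : M ⟶ N) [Mono f] (U : Cᵒᵖ) :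
    Function.Injective (f.val.app U) :=
  (ModuleCat.mono_iff_injective _).1 (inferInstanceAs (Mono ((evaluation R U).map f)))

theorem mono_of_app_injective {M N : SheafOfModules.{u} R} (f : M ⟶ N)
    (h : ∀ U, Function.Injective (f.val.app U)) : Mono f :=
  (forget R).mono_of_mono_map (PresheafOfModules.mono_of_injective h)

/-- The value of a section of a sheaf of modules on an object. -/
def sectionAt {N : SheafOfModules.{u} R} (s : N.sections) (V : Cᵒᵖ) : N.val.obj V := s.val V

theorem unit_hom_app_apply {N : SheafOfModules.{u} R} (f : unit R ⟶ N) (V : Cᵒᵖ)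
    (r : R.obj.obj V) : f.val.app V r = r • sectionAt (N.unitHomEquiv f) V := by
  have h := (f.val.app V).hom.map_smul r (1 : R.obj.obj V)
  exact (congr_arg _ (mul_one r).symm).trans h

variable [HasSheafify J AddCommGrpCat.{u}] [J.WEqualsLocallyBijective AddCommGrpCat.{u}]

/-- Epimorphisms of sheaves of modules are epimorphisms of the underlying abelian sheaves. -/
instance preservesEpimorphisms_toSheaf : (toSheaf.{u} R).PreservesEpimorphisms where
  preserves {M N} f hf := by
    let L := PresheafOfModules.sheafification.{u} (𝟙 R.obj)
    let G := PresheafOfModules.toPresheaf.{u} R.obj ⋙ presheafToSheaf J AddCommGrpCat.{u}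
    let e : L ⋙ toSheaf R ≅ G := PresheafOfModules.sheafificationCompToSheaf (𝟙 R.obj)
    let F := forget.{u} R ⋙ PresheafOfModules.restrictScalars (𝟙 R.obj)
    let adj : L ⊣ F := PresheafOfModules.sheafificationAdjunction (𝟙 R.obj)
    let g := F.map f
    have : Epi (L.map g) := by
      have h : adj.counit.app M ≫ f = L.map g ≫ adj.counit.app N := (adj.counit.naturality f).symm
      have : L.map g = adj.counit.app M ≫ f ≫ inv (adj.counit.app N) := by
        rw [reassoc_of% h]; simp
      rw [this]
      infer_instance
    have hL : Epi (L.map (factorThruImage g) ≫ L.map (image.ι g)) := by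
      rwa [← L.map_comp, image.fac]
    have : Epi (L.map (image.ι g)) := epi_of_epi (L.map (factorThruImage g)) _
    have : IsIso (L.map (image.ι g)) := isIso_of_mono_of_epi _
    have : Epi (G.map (factorThruImage g)) := by
      dsimp [G]; infer_instance
    have h1 : Epi ((toSheaf R).map (L.map (factorThruImage g))) := by
      change Epi ((L ⋙ toSheaf R).map _)
      rw [← NatIso.naturality_2 e]
      infer_instance
    have h : Epi ((toSheaf R).map (L.map g)) := by
      rw [← image.fac g, L.map_comp, Functor.map_comp]
      infer_instance
    have h : (toSheaf R).map f = (toSheaf R).map (inv (adj.counit.app M)) ≫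
        (toSheaf R).map (L.map g) ≫ (toSheaf R).map (adj.counit.app N) := by
      simp only [← Functor.map_comp]
      congr 1
      rw [IsIso.eq_inv_comp]
      exact (adj.counit.naturality f).symm
    rw [h]
    infer_instance

theorem epi_iff_locally_surjective {M N : SheafOfModules.{u} R} (f : M ⟶ N) :
    Epi f ↔ ∀ (U : C) (s : N.val.obj (op U)), ∃ S ∈ J U, ∀ (V : C) (i : V ⟶ U), S i →
      ∃ t : M.val.obj (op V), f.val.app (op V) t = N.val.restrictₛₗ i.op s := by
  have h : Epi f ↔ Epi ((toSheaf R).map f) :=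
    ⟨fun _ => inferInstance, fun h => (toSheaf R).epi_of_epi_map h⟩
  rw [h, ← Sheaf.isLocallySurjective_iff_epi']
  constructor
  · intro h U s
    exact ⟨Presheaf.imageSieve ((toSheaf R).map f).hom (U := U) s,
      Presheaf.imageSieve_mem J ((toSheaf R).map f).hom (U := op U) s, fun V i h => h⟩
  · intro h
    refine ⟨fun {U} s => ?_⟩
    obtain ⟨S, hS, h⟩ := h U s
    exact J.superset_covering (fun V i hi => h V i hi) hS

instance (U : Cᵒᵖ) : (evaluation.{u} R U).Additive where

theorem exists_app_eq_of_exact {S : ShortComplex (SheafOfModules.{u} R)} (hS : S.Exact)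
    [Mono S.f] (U : Cᵒᵖ) (x : S.X₂.val.obj U) (hx : S.g.val.app U x = 0) :
    ∃ y : S.X₁.val.obj U, S.f.val.app U y = x :=
  (ShortComplex.moduleCat_exact_iff _).1
    (hS.map_of_mono_of_preservesKernel (evaluation R U) inferInstance inferInstance) x hx

theorem locally_exists_app_eq_of_exact {S : ShortComplex (SheafOfModules.{u} R)} (hS : S.Exact)
    (U : C) (x : S.X₂.val.obj (op U)) (hx : S.g.val.app (op U) x = 0) :
    ∃ T ∈ J U, ∀ (V : C) (i : V ⟶ U), T i →
      ∃ t : S.X₁.val.obj (op V), S.f.val.app (op V) t = S.X₂.val.restrictₛₗ i.op x := by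
  obtain ⟨y, rfl⟩ := exists_app_eq_of_exact
    (ShortComplex.exact_of_f_is_kernel (.mk (kernel.ι S.g) S.g (by simp)) (kernelIsKernel S.g))
    (op U) x hx
  have := (S.exact_iff_epi_kernel_lift).1 hS
  obtain ⟨T, hT, h⟩ := (epi_iff_locally_surjective _).1 this U y
  refine ⟨T, hT, fun V i hi => ?_⟩
  obtain ⟨t, ht⟩ := h V i hi
  refine ⟨t, ?_⟩
  dsimp only at y ⊢
  rw [PresheafOfModules.restrictₛₗ_apply] at ht ⊢
  rw [← PresheafOfModules.naturality_apply, ← ht]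
  exact congr($(congr_arg Hom.val (kernel.lift_ι S.g S.f S.zero).symm).app (op V) t)

section
variable {I : Type u}

open Classical in
/-- The `i`-th coordinate projection of a free sheaf of modules. -/
noncomputable def freeProj (i : I) : free (R := R) I ⟶ unit R :=
  Sigma.desc fun j => if j = i then 𝟙 _ else 0

open Classical in
theorem ι_freeProj (i j : I) : ιFree j ≫ freeProj (R := R) i = if j = i then 𝟙 _ else 0 :=
  Sigma.ι_desc _ _

theorem sum_freeProj_ι [Fintype I] : ∑ i, freeProj (R := R) i ≫ ιFree (I := I) i = 𝟙 _ := by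
  classical
  apply Sigma.hom_ext
  intro j
  change ιFree j ≫ _ = ιFree j ≫ _
  simp [Preadditive.comp_sum, reassoc_of% (ι_freeProj (R := R)), ite_comp]

/-- The coordinates of a section of a free sheaf of modules. -/
noncomputable def coord {V : Cᵒᵖ} (a : (free (R := R) I).val.obj V) (i : I) : R.obj.obj V :=
  (freeProj i).val.app V a

theorem free_hom_app_apply [Fintype I] {N : SheafOfModules.{u} R} (p : free I ⟶ N) {V : Cᵒᵖ}
    (a : (free (R := R) I).val.obj V) :
    p.val.app V a = ∑ i, coord a i • sectionAt (N.freeHomEquiv p i) V := by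
  have h : p = ∑ i, freeProj i ≫ ιFree i ≫ p := by
    simp_rw [← Category.assoc, ← Preadditive.sum_comp, sum_freeProj_ι, Category.id_comp]
  have h' : (evaluation R V).map p = ∑ i, (evaluation R V).map (freeProj i ≫ ιFree i ≫ p) := by
    rw [← Functor.map_sum, ← h]
  refine (congr($(h').hom a)).trans ?_
  rw [ModuleCat.hom_sum]
  refine (LinearMap.sum_apply _ _ _).trans (Finset.sum_congr rfl fun i _ => ?_)
  exact unit_hom_app_apply (ιFree i ≫ p) V (coord a i)

theorem coord_sum_smul_freeSection [Fintype I] {V : Cᵒᵖ} (r : I → R.obj.obj V) (i : I) :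
    coord (∑ j, r j • sectionAt (freeSection j) V : (free (R := R) I).val.obj V) i = r i := by
  classical
  have h : ∀ j, (freeProj i).val.app V (sectionAt (freeSection (R := R) j) V) =
      (if j = i then 1 else 0 : R.obj.obj V) := by
    intro j
    have := congr(($(ι_freeProj (R := R) i j)).val.app V (1 : R.obj.obj V))
    refine this.trans ?_
    split_ifs <;> rfl
  refine (map_sum ((freeProj i).val.app V).hom _ _).trans ?_
  refine (Finset.sum_congr rfl fun j _ =>
    ((((freeProj i).val.app V).hom.map_smul _ _).trans (congr_arg (r j • ·) (h j)))).trans ?_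
  change ∑ j, r j * _ = _
  simp

theorem coord_map {V W : Cᵒᵖ} (f : V ⟶ W) (a : (free (R := R) I).val.obj V) (i : I) :
    coord ((free I).val.restrictₛₗ f a) i = R.obj.map f (coord a i) :=
  PresheafOfModules.naturality_apply (freeProj (R := R) i).val f a

theorem exists_free_hom_app_eq [Fintype I] {N : SheafOfModules.{u} R} (p : free I ⟶ N) {V : Cᵒᵖ}
    (r : I → R.obj.obj V) :
    ∃ a, p.val.app V a = ∑ i, r i • sectionAt (N.freeHomEquiv p i) V :=
  ⟨∑ j, r j • sectionAt (freeSection j) V, by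
    rw [free_hom_app_apply]; simp_rw [coord_sum_smul_freeSection]⟩

/-- A morphism from a finite free sheaf of modules is an epimorphism if and only if the
corresponding sections locally generate. -/
theorem epi_iff_locally_exists_sum_smul [Fintype I] {N : SheafOfModules.{u} R} (p : free I ⟶ N) :
    Epi p ↔ ∀ (U : C) (s : N.val.obj (op U)), ∃ S ∈ J U, ∀ (V : C) (i : V ⟶ U), S i →
      ∃ r : I → R.obj.obj (op V),
        N.val.restrictₛₗ i.op s = ∑ k, r k • sectionAt (N.freeHomEquiv p k) (op V) := by
  rw [epi_iff_locally_surjective]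
  refine forall₂_congr fun U s => exists_congr fun S => and_congr_right fun _ =>
    forall₃_congr fun V i _ => ⟨?_, ?_⟩
  · rintro ⟨t, ht⟩
    exact ⟨coord t, by rw [← ht, free_hom_app_apply]⟩
  · rintro ⟨r, hr⟩
    obtain ⟨a, ha⟩ := exists_free_hom_app_eq p r
    exact ⟨a, ha.trans hr.symm⟩

/-- In a finite presentation, linear relations between the generators locally come from the
given relations. -/
theorem locally_exists_eq_sum_mul_coord {K : Type u} [Fintype I] [Fintype K]
    {N : SheafOfModules.{u} R}
    {f : free (R := R) K ⟶ free I} {p : free I ⟶ N} {w : f ≫ p = 0}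
    (h : (ShortComplex.mk f p w).Exact) (U : C) (r : I → R.obj.obj (op U))
    (hr : ∑ i, r i • sectionAt (N.freeHomEquiv p i) (op U) = 0) :
    ∃ S ∈ J U, ∀ (V : C) (j : V ⟶ U), S j → ∃ e : K → R.obj.obj (op V), ∀ i,
      R.obj.map j.op (r i) =
        ∑ k, e k * coord (sectionAt (freeHomEquiv _ f k) (op V)) i := by
  have h0 : p.val.app (op U) (∑ j, r j • sectionAt (freeSection j) (op U)) = 0 := by
    rw [free_hom_app_apply]; simp_rw [coord_sum_smul_freeSection]; exact hr
  obtain ⟨S, hS, h⟩ := locally_exists_app_eq_of_exact h U _ h0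
  refine ⟨S, hS, fun V j hj => ?_⟩
  obtain ⟨t, ht⟩ := h V j hj
  refine ⟨coord t, fun i => ?_⟩
  have h1 := congr_arg (coord · i) ht
  dsimp only at h1
  rw [coord_map, coord_sum_smul_freeSection, free_hom_app_apply] at h1
  rw [← h1]
  refine (map_sum ((freeProj i).val.app (op V)).hom _ _).trans
    (Finset.sum_congr rfl fun k _ => ((freeProj i).val.app (op V)).hom.map_smul _ _)

end

end SheafOfModules

namespace CoherentSheaves

open Opposite

variable {X : TopCat.{u}} {R : Sheaf (Opens.grothendieckTopology X) RingCat.{u}}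

/-- The restriction map of a sheaf of rings along an inclusion of open subsets. -/
noncomputable abbrev ringRes {V W : Opens X} (h : W ≤ V) :
    R.obj.obj (op V) →+* R.obj.obj (op W) :=
  (R.obj.map (homOfLE h).op).hom

/-- The restriction map of a sheaf of modules along an inclusion of open subsets. -/
noncomputable def modRes (M : SheafOfModules.{u} R) {V W : Opens X} (h : W ≤ V) :
    M.val.obj (op V) →ₛₗ[ringRes (R := R) h] M.val.obj (op W) :=
  M.val.restrictₛₗ (homOfLE h).op

theorem modRes_modRes (M : SheafOfModules.{u} R) {U V W : Opens X} (h : V ≤ U) (k : W ≤ V)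
    (s : M.val.obj (op U)) : modRes M k (modRes M h s) = modRes M (k.trans h) s :=
  (M.val.map_comp_apply (homOfLE h).op (homOfLE k).op s).symm

theorem modRes_self (M : SheafOfModules.{u} R) {U : Opens X} (s : M.val.obj (op U)) :
    modRes M le_rfl s = s := by
  change M.val.map (𝟙 _) s = s
  rw [M.val.map_id]
  rfl

theorem ringRes_ringRes {U V W : Opens X} (h : V ≤ U) (k : W ≤ V)
    (r : R.obj.obj (op U)) : ringRes k (ringRes h r) = ringRes (R := R) (k.trans h) r :=
  congr($((R.obj.map_comp (homOfLE h).op (homOfLE k).op).symm).hom r)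

theorem app_modRes {M N : SheafOfModules.{u} R} (f : M ⟶ N) {V W : Opens X} (h : W ≤ V)
    (s : M.val.obj (op V)) : f.val.app (op W) (modRes M h s) = modRes N h (f.val.app (op V) s) :=
  PresheafOfModules.naturality_apply f.val (homOfLE h).op s

/-- A family of sections on `U` generates `M` locally on `U`. -/
def LocallyGenerates (M : SheafOfModules.{u} R) {U : Opens X} {I : Type*} [Fintype I]
    (s : I → M.val.obj (op U)) : Prop :=
  ∀ ⦃V : Opens X⦄ (h : V ≤ U) (t : M.val.obj (op V)), ∀ x ∈ V, ∃ (W : Opens X) (k : W ≤ V),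
    x ∈ W ∧ ∃ r : I → R.obj.obj (op W), modRes M k t = ∑ i, r i • modRes M (k.trans h) (s i)

theorem exists_le_of_mem_over {U : Opens X} {Y : Over U} {S : Sieve Y}
    (hS : S ∈ (Opens.grothendieckTopology X).over U Y) {x : X} (hx : x ∈ Y.left) :
    ∃ (W : Opens X) (k : W ≤ Y.left), x ∈ W ∧
      S (Over.homMk (homOfLE k) : Over.mk (homOfLE (k.trans Y.hom.le)) ⟶ Y) := by
  obtain ⟨W, f, hf, hxW⟩ := (GrothendieckTopology.mem_over_iff _ _).1 hS x hx
  exact ⟨W, f.le, hxW, (Sieve.overEquiv_iff S f).1 hf⟩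

theorem mem_over_of_exists_le {U : Opens X} {Y : Over U} {S : Sieve Y}
    (hS : ∀ x ∈ Y.left, ∃ (W : Opens X) (k : W ≤ Y.left), x ∈ W ∧
      S (Over.homMk (homOfLE k) : Over.mk (homOfLE (k.trans Y.hom.le)) ⟶ Y)) :
    S ∈ (Opens.grothendieckTopology X).over U Y := by
  refine (GrothendieckTopology.mem_over_iff _ _).2 fun x hx => ?_
  obtain ⟨W, k, hxW, hk⟩ := hS x hx
  exact ⟨W, homOfLE k, (Sieve.overEquiv_iff S _).2 hk, hxW⟩

/-- The value on `U` of a section of `M.over U`. -/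
noncomputable def topSection {M : SheafOfModules.{u} R} {U : Opens X} (s : (M.over U).sections) :
    M.val.obj (op U) :=
  SheafOfModules.sectionAt s (op (Over.mk (𝟙 U)))

theorem modRes_topSection {M : SheafOfModules.{u} R} {U : Opens X} (s : (M.over U).sections)
    (Y : Over U) :
    modRes M Y.hom.le (topSection s) = SheafOfModules.sectionAt s (op Y) :=
  s.property (Over.homMk Y.hom : Y ⟶ Over.mk (𝟙 U)).op

/-- The section of `M.over U` with a given value on `U`. -/
noncomputable def sectionOfTop {M : SheafOfModules.{u} R} {U : Opens X} (t : M.val.obj (op U)) :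
    (M.over U).sections :=
  PresheafOfModules.sectionsMk (M := (M.over U).val)
    (fun Y => modRes M Y.unop.hom.le t) fun _ _ _ => modRes_modRes M _ _ t

theorem topSection_sectionOfTop {M : SheafOfModules.{u} R} {U : Opens X} (t : M.val.obj (op U)) :
    topSection (sectionOfTop t) = t :=
  modRes_self M t

theorem epi_over_iff {M : SheafOfModules.{u} R} {U : Opens X} {I : Type u} [Fintype I]
    (p : SheafOfModules.free I ⟶ M.over U) :
    Epi p ↔ LocallyGenerates M fun i => topSection ((M.over U).freeHomEquiv p i) := by
  rw [SheafOfModules.epi_iff_locally_exists_sum_smul]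
  constructor
  · intro H V h t x hx
    obtain ⟨S, hS, H⟩ := H (Over.mk (homOfLE h)) t
    obtain ⟨W, k, hxW, hk⟩ := exists_le_of_mem_over hS hx
    obtain ⟨r, hr⟩ := H _ _ hk
    refine ⟨W, k, hxW, r, hr.trans (Finset.sum_congr rfl fun i _ => ?_)⟩
    rw [← modRes_topSection]
    rfl
  · intro H Y t
    let S : Sieve Y :=
      { arrows := fun Z j => ∃ r : I → R.obj.obj (op Z.left), modRes M j.left.le t =
          ∑ i, r i • modRes M Z.hom.le (topSection ((M.over U).freeHomEquiv p i))
        downward_closed := by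
          rintro Z Z' j ⟨r, hr⟩ j'
          refine ⟨fun i => ringRes j'.left.le (r i), ?_⟩
          have := congr_arg (modRes M j'.left.le) hr
          rw [map_sum] at this
          refine (modRes_modRes M j.left.le j'.left.le t).symm.trans
            (this.trans (Finset.sum_congr rfl fun i _ => ?_))
          rw [map_smulₛₗ, modRes_modRes] }
    refine ⟨S, mem_over_of_exists_le fun x hx => ?_, ?_⟩
    · obtain ⟨W, k, hxW, h⟩ := H Y.hom.le t x hx
      exact ⟨W, k, hxW, h⟩
    · rintro Z j ⟨r, hr⟩
      refine ⟨r, hr.trans (Finset.sum_congr rfl fun i _ => ?_)⟩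
      rw [modRes_topSection]
      rfl

/-- The relations `c` locally generate the relations between the sections `t`. -/
def LocallyGenerateRelations (M : SheafOfModules.{u} R) {U : Opens X} {I K : Type*} [Fintype I]
    [Fintype K] (t : I → M.val.obj (op U)) (c : K → I → R.obj.obj (op U)) : Prop :=
  (∀ k, ∑ i, c k i • t i = 0) ∧
    ∀ ⦃V : Opens X⦄ (hV : V ≤ U) (r : I → R.obj.obj (op V)), ∑ i, r i • modRes M hV (t i) = 0 →
      ∀ x ∈ V, ∃ (W : Opens X) (k : W ≤ V), x ∈ W ∧ ∃ e : K → R.obj.obj (op W), ∀ i,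
        ringRes k (r i) = ∑ l, e l * ringRes (k.trans hV) (c l i)

theorem LocallyGenerateRelations.restrict {M : SheafOfModules.{u} R} {U V : Opens X}
    {I K : Type*} [Fintype I] [Fintype K] {t : I → M.val.obj (op U)}
    {c : K → I → R.obj.obj (op U)} (ht : LocallyGenerateRelations M t c) (h : V ≤ U) :
    LocallyGenerateRelations M (fun i => modRes M h (t i)) fun k i => ringRes h (c k i) := by
  refine ⟨fun k => ?_, fun W hW r hr x hx => ?_⟩
  · simpa using congr_arg (modRes M h) (ht.1 k)
  · simp_rw [modRes_modRes] at hr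
    simp_rw [ringRes_ringRes]
    exact ht.2 (hW.trans h) r hr x hx

theorem exists_relations {M : SheafOfModules.{u} R} {U : Opens X} {I K : Type u} [Fintype I]
    [Fintype K] {f : SheafOfModules.free (R := R.over U) K ⟶ SheafOfModules.free I}
    {p : SheafOfModules.free I ⟶ M.over U} {w : f ≫ p = 0}
    (h : (ShortComplex.mk f p w).Exact) :
    ∃ c : K → I → R.obj.obj (op U),
      LocallyGenerateRelations M (fun i => topSection ((M.over U).freeHomEquiv p i)) c := by
  refine ⟨fun k => SheafOfModules.coord (R := R.over U)
    (SheafOfModules.sectionAt (SheafOfModules.freeHomEquiv _ f k) (op (Over.mk (𝟙 U)))), ?_, ?_⟩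
  · intro k
    refine (SheafOfModules.free_hom_app_apply p _).symm.trans ?_
    exact congr(topSection ((M.over U).freeHomEquiv $w k))
  · intro V hV r hr x hx
    obtain ⟨S, hS, H⟩ := SheafOfModules.locally_exists_eq_sum_mul_coord h (Over.mk (homOfLE hV)) r
      (by
        refine Eq.trans (Finset.sum_congr rfl fun i _ => ?_) hr
        rw [← modRes_topSection]
        rfl)
    obtain ⟨W, k, hxW, hk⟩ := exists_le_of_mem_over hS hx
    obtain ⟨e, he⟩ := H _ _ hk
    refine ⟨W, k, hxW, e, fun i => (he i).trans (Finset.sum_congr rfl fun l _ => ?_)⟩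
    refine congr_arg (e l * ·) ?_
    have := (SheafOfModules.freeHomEquiv _ f l).property
      (Over.homMk (homOfLE (k.trans hV)) : Over.mk (homOfLE (k.trans hV)) ⟶ Over.mk (𝟙 U)).op
    exact (congr_arg (SheafOfModules.coord · i) this.symm).trans
      (SheafOfModules.coord_map (R := R.over U) _ _ i)

theorem LocallyGenerates.exists_epi {M : SheafOfModules.{u} R} {U : Opens X} {I : Type*}
    [Fintype I] [Nonempty I] {s : I → M.val.obj (op U)} (hs : LocallyGenerates M s) :
    ∃ n : ℕ, 0 < n ∧ ∃ p : SheafOfModules.free (ULift.{u} (Fin n)) ⟶ M.over U, Epi p := by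
  refine ⟨Fintype.card I, Fintype.card_pos, ?_⟩
  let e : ULift.{u} (Fin (Fintype.card I)) ≃ I := Equiv.ulift.trans (Fintype.equivFin I).symm
  refine ⟨(M.over U).freeHomEquiv.symm fun i => sectionOfTop (s (e i)), ?_⟩
  rw [epi_over_iff, Equiv.apply_symm_apply]
  simp_rw [topSection_sectionOfTop]
  intro V h t x hx
  obtain ⟨W, k, hxW, r, hr⟩ := hs h t x hx
  refine ⟨W, k, hxW, r ∘ e, hr.trans ?_⟩
  exact (e.sum_comp fun i => r i • modRes M (k.trans h) (s i)).symm

theorem LocallyGenerates.restrict {M : SheafOfModules.{u} R} {U V : Opens X} {I : Type*}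
    [Fintype I] {s : I → M.val.obj (op U)} (hs : LocallyGenerates M s) (h : V ≤ U) :
    LocallyGenerates M fun i => modRes M h (s i) := by
  intro W k t x hx
  obtain ⟨W', k', hxW, r, hr⟩ := hs (k.trans h) t x hx
  refine ⟨W', k', hxW, r, ?_⟩
  simp_rw [modRes_modRes]
  exact hr

/-- Finitely many local conditions can be satisfied on a common neighborhood. -/
theorem exists_common_nhd {I : Type*} [Finite I] {U : Opens X} {x : X} (hxU : x ∈ U)
    {P : I → Opens X → Prop} (hP : ∀ i, ∃ W ≤ U, x ∈ W ∧ P i W)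
    (hmono : ∀ i V W, W ≤ V → P i V → P i W) : ∃ W ≤ U, x ∈ W ∧ ∀ i, P i W := by
  have := Fintype.ofFinite I
  choose W hW hxW h using hP
  refine ⟨U ⊓ Finset.univ.inf W, inf_le_left, ⟨hxU, ?_⟩, fun i => hmono i _ _
    (inf_le_right.trans (Finset.inf_le (Finset.mem_univ i))) (h i)⟩
  change x ∈ Finset.univ.inf W
  simpa [← SetLike.mem_coe, Opens.coe_finset_inf] using hxW

theorem locally_exists_app_eq_of_epi {M N : SheafOfModules.{u} R} (g : M ⟶ N) [Epi g]
    {U : Opens X} (t : N.val.obj (op U)) {x : X} (hx : x ∈ U) :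
    ∃ (W : Opens X) (k : W ≤ U), x ∈ W ∧ ∃ s, g.val.app (op W) s = modRes N k t := by
  obtain ⟨S, hS, h⟩ := (SheafOfModules.epi_iff_locally_surjective g).1 ‹_› U t
  obtain ⟨W, f, hf, hxW⟩ := hS x hx
  exact ⟨W, f.le, hxW, h W f hf⟩

/-- If the sections `s` generate the middle term of a short exact sequence, and the sections `m`
map to sections with finitely generated relations and whose span contains the images of `s`, then
the kernel is finitely generated. -/
theorem exists_locallyGenerates_of_shortExact {S : ShortComplex (SheafOfModules.{u} R)}
    (hS : S.ShortExact) {U : Opens X} {H I K : Type*} [Fintype H] [Fintype I] [Fintype K]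
    {s : H → S.X₂.val.obj (op U)} (hs : LocallyGenerates S.X₂ s)
    (m : I → S.X₂.val.obj (op U)) {c : K → I → R.obj.obj (op U)}
    (hc : LocallyGenerateRelations S.X₃ (fun i => S.g.val.app (op U) (m i)) c)
    (b : H → I → R.obj.obj (op U))
    (hb : ∀ j, S.g.val.app (op U) (s j) = ∑ i, b j i • S.g.val.app (op U) (m i)) :
    ∃ y : H ⊕ K → S.X₁.val.obj (op U), LocallyGenerates S.X₁ y := by
  have := hS.mono_f
  have hy (j : H) : ∃ y, S.f.val.app (op U) y = s j - ∑ i, b j i • m i := by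
    refine SheafOfModules.exists_app_eq_of_exact hS.exact _ _ ?_
    simp [hb]
  have hz (l : K) : ∃ z, S.f.val.app (op U) z = ∑ i, c l i • m i := by
    refine SheafOfModules.exists_app_eq_of_exact hS.exact _ _ ?_
    simpa using hc.1 l
  choose y hy using hy
  choose z hz using hz
  refine ⟨Sum.elim y z, fun V h t x hx => ?_⟩
  obtain ⟨W, k, hxW, r, hr⟩ := hs h (S.f.val.app (op V) t) x hx
  rw [← app_modRes] at hr
  have hg : S.g.val.app (op W) (S.f.val.app (op W) (modRes S.X₁ k t)) = 0 :=
    congr(($(S.zero)).val.app (op W) (modRes S.X₁ k t))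
  have hd : ∑ i, (∑ j, r j * ringRes (k.trans h) (b j i)) •
      modRes S.X₃ (k.trans h) (S.g.val.app (op U) (m i)) = 0 := by
    rw [hr] at hg
    simp only [map_sum, map_smul, app_modRes, hb, map_smulₛₗ, Finset.smul_sum] at hg
    rw [Finset.sum_comm] at hg
    simpa only [Finset.sum_smul, mul_smul] using hg
  obtain ⟨W', k', hxW', e, he⟩ := hc.2 (k.trans h) _ hd x hxW
  refine ⟨W', k'.trans k, hxW', Sum.elim (fun j => ringRes k' (r j)) e, ?_⟩
  apply SheafOfModules.app_injective S.f
  have hr' := congr_arg (modRes S.X₂ k') hr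
  rw [← app_modRes, modRes_modRes] at hr'
  rw [hr']
  simp only [map_sum, map_smul, map_smulₛₗ, modRes_modRes, app_modRes, Fintype.sum_sum_type,
    Sum.elim_inl, Sum.elim_inr, hy, hz, map_add, map_sub, smul_sub, Finset.sum_sub_distrib]
  have key : ∑ j, ringRes k' (r j) • ∑ i, ringRes ((k'.trans k).trans h) (b j i) •
        modRes S.X₂ ((k'.trans k).trans h) (m i) =
      ∑ l, e l • ∑ i, ringRes ((k'.trans k).trans h) (c l i) •
        modRes S.X₂ ((k'.trans k).trans h) (m i) := by
    simp only [Finset.smul_sum, ← mul_smul]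
    rw [Finset.sum_comm, Finset.sum_comm (s := (Finset.univ : Finset K))]
    refine Finset.sum_congr rfl fun i _ => ?_
    rw [← Finset.sum_smul, ← Finset.sum_smul, ← he i]
    simp only [map_sum, map_mul, ringRes_ringRes]
  rw [key, sub_add_cancel]

theorem isPseudoCoherent_of_mono {M N : SheafOfModules.{u} R} (f : M ⟶ N) [Mono f]
    (hN : IsPseudoCoherent N) : IsPseudoCoherent M := by
  intro U F ι _ hF
  have : Mono (f.over U) := SheafOfModules.mono_of_app_injective _ fun Y =>
    SheafOfModules.app_injective f (op Y.unop.left)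
  exact hN U F (ι ≫ f.over U) inferInstance hF

/-- The kernel of an epimorphism from a locally finitely generated sheaf of modules to a locally
finitely presented one is locally finitely generated. -/
theorem isLFG_of_isLFG_isLFP {S : ShortComplex (SheafOfModules.{u} R)} (hS : S.ShortExact)
    (hM : IsLFG S.X₂) (hM'' : IsLFP S.X₃) : IsLFG S.X₁ := by
  intro x
  have := hS.epi_g
  obtain ⟨U₁, hx₁, h, hh, p, hp⟩ := hM x
  obtain ⟨U₂, hx₂, k, n, hk, hn, f, q, w, hq, hfq⟩ := hM'' x
  obtain ⟨c, hc⟩ := exists_relations hfq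
  rw [epi_over_iff] at hp hq
  obtain ⟨U₃, h₃, hx₃, hm⟩ := exists_common_nhd hx₂
    (P := fun i W => ∃ (l : W ≤ U₂) (s : _),
      S.g.val.app (op W) s = modRes S.X₃ l (topSection ((S.X₃.over U₂).freeHomEquiv q i)))
    (fun i => by
      obtain ⟨W, l, hxW, s, hs⟩ := locally_exists_app_eq_of_epi S.g
        (topSection ((S.X₃.over U₂).freeHomEquiv q i)) hx₂
      exact ⟨W, l, hxW, l, s, hs⟩)
    (by
      rintro i V W hWV ⟨l, s, hs⟩
      exact ⟨hWV.trans l, modRes S.X₂ hWV s, by rw [app_modRes, hs, modRes_modRes]⟩)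
  choose _ m hm using hm
  obtain ⟨U₄, h₄, hx₄, hb⟩ := exists_common_nhd (U := U₁ ⊓ U₃) ⟨hx₁, hx₃⟩
    (P := fun j W => ∃ (l₁ : W ≤ U₁) (l₂ : W ≤ U₂) (b : _ → R.obj.obj (op W)),
      modRes S.X₃ l₁ (S.g.val.app (op U₁) (topSection ((S.X₂.over U₁).freeHomEquiv p j))) =
        ∑ i, b i • modRes S.X₃ l₂ (topSection ((S.X₃.over U₂).freeHomEquiv q i)))
    (fun j => by
      obtain ⟨W, l, hxW, b, hb⟩ := hq (inf_le_right.trans h₃) (modRes S.X₃ inf_le_left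
        (S.g.val.app (op U₁) (topSection ((S.X₂.over U₁).freeHomEquiv p j)))) x ⟨hx₁, hx₃⟩
      rw [modRes_modRes] at hb
      exact ⟨W, l, hxW, _, _, b, hb⟩)
    (by
      rintro i V W hWV ⟨l₁, l₂, b, hb⟩
      refine ⟨hWV.trans l₁, hWV.trans l₂, fun i => ringRes hWV (b i), ?_⟩
      rw [← modRes_modRes _ l₁ hWV, hb]
      simp only [map_sum, map_smulₛₗ, modRes_modRes])
  choose l₁ l₂ b hb using hb
  have l₃ : U₄ ≤ U₃ := h₄.trans inf_le_right
  have hgm (i) : S.g.val.app (op U₄) (modRes S.X₂ l₃ (m i)) =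
      modRes S.X₃ (l₃.trans h₃) (topSection ((S.X₃.over U₂).freeHomEquiv q i)) := by
    rw [app_modRes, hm, modRes_modRes]
  have hc' := LocallyGenerateRelations.restrict hc (l₃.trans h₃)
  simp_rw [← hgm] at hc' hb
  have : Nonempty (ULift.{u} (Fin h)) := ⟨⟨⟨0, hh⟩⟩⟩
  obtain ⟨y, hy⟩ := exists_locallyGenerates_of_shortExact hS
    (hp.restrict (h₄.trans inf_le_left)) (fun i => modRes S.X₂ l₃ (m i)) hc' b
    (fun j => by rw [app_modRes]; exact hb j)
  exact ⟨U₄, hx₄, hy.exists_epi⟩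

/-- In a short exact sequence, if `M` is coherent and `M''` is locally finitely
presented, then `M'` is coherent. -/
theorem isCoherent_of_isCoherent_isLFP (S : CategoryTheory.ShortComplex (SheafOfModules.{u} R)) (hS : S.ShortExact)
    (hM : IsCoherent S.X₂) (hM'' : IsLFP S.X₃) : IsCoherent S.X₁ :=
  have := hS.mono_f
  ⟨isLFG_of_isLFG_isLFP hS hM.1 hM'', isPseudoCoherent_of_mono S.f hM.2⟩

end CoherentSheaves
end
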